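/- arXiv:2306.17504 — 2 statements merged into one kernel-verified Lean document; each statement's English description precedes it below -/
import Mathlib

section
/- Let f : ℝ^d → ℝ be differentiable with G-bounded gradient and L-smooth, and let g be a stochastic gradient oracle for f with variance σ² on a probability space (Ω, P). Then for every ρ > 0 and every w ∈ ℝ^d with ∇f(w) ≠ 0: E_ω[⟨∇f(w), g(w + ρ·g(w,ω)/‖g(w,ω)‖, ω)⟩] ≥ (1/2)·‖∇f(w)‖² − 2L²ρ² − L·ρ·G. (Lemma 2 of the paper.) -/
open MeasureTheory
open scoped RealInnerProductSpace

/-- **Lemma 2.** For differentiable `f` with `G`-bounded gradient and `L`-smoothness, and a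
stochastic gradient oracle `g` for `f` with variance `σ²`, for every `ρ > 0` and `w` with
`∇f(w) ≠ 0`:
`E_ω⟪∇f(w), g(w + ρ·g(w,ω)/‖g(w,ω)‖, ω)⟫ ≥ ½‖∇f(w)‖² − 2L²ρ² − LρG`. -/
theorem lemma2_sam_stochastic_inner_bound {d : ℕ}
    {Ω : Type*} [MeasurableSpace Ω] (P : Measure Ω) [IsProbabilityMeasure P]
    (f : EuclideanSpace ℝ (Fin d) → ℝ) (f' : EuclideanSpace ℝ (Fin d) → EuclideanSpace ℝ (Fin d))
    (g : EuclideanSpace ℝ (Fin d) → Ω → EuclideanSpace ℝ (Fin d))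
    (G L σ ρ : ℝ) (hG : 0 ≤ G) (hL : 0 < L) (hρ : 0 < ρ)
    (hgrad : ∀ w, HasGradientAt f (f' w) w)
    (hbound : ∀ w, ‖f' w‖ ≤ G)
    (hsmooth : ∀ w v, ‖f' w - f' v‖ ≤ L * ‖w - v‖)
    (hgmeas : Measurable fun p : EuclideanSpace ℝ (Fin d) × Ω => g p.1 p.2)
    (hglip : ∀ ω w v, ‖g w ω - g v ω‖ ≤ L * ‖w - v‖)
    (hgne : ∀ w ω, g w ω ≠ 0)
    (hgint : ∀ w, Integrable (fun ω => g w ω) P)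
    (hunbiased : ∀ w, ∫ ω, g w ω ∂P = f' w)
    (hvarint : ∀ w, Integrable (fun ω => ‖g w ω - f' w‖ ^ 2) P)
    (hvar : ∀ w, ∫ ω, ‖g w ω - f' w‖ ^ 2 ∂P ≤ σ ^ 2)
    (w : EuclideanSpace ℝ (Fin d)) (hw : f' w ≠ 0) :
    ∫ ω, ⟪f' w, g (w + ρ • ‖g w ω‖⁻¹ • g w ω) ω⟫ ∂P
      ≥ (1 / 2) * ‖f' w‖ ^ 2 - 2 * L ^ 2 * ρ ^ 2 - L * ρ * G := by
  have hm0 : Measurable fun ω => g w ω := hgmeas.comp (measurable_const.prodMk measurable_id)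
  have hm1 : Measurable fun ω => g (w + ρ • ‖g w ω‖⁻¹ • g w ω) ω := by
    have h : Measurable fun ω => (w + ρ • ‖g w ω‖⁻¹ • g w ω, ω) := by
      refine Measurable.prodMk ?_ measurable_id
      exact measurable_const.add ((hm0.norm.inv.smul hm0).const_smul ρ)
    exact hgmeas.comp h
  have hd : ∀ ω, ‖g (w + ρ • ‖g w ω‖⁻¹ • g w ω) ω - g w ω‖ ≤ L * ρ := by
    intro ω
    refine (hglip ω _ _).trans (le_of_eq ?_)
    have h0 : ‖g w ω‖ ≠ 0 := norm_ne_zero_iff.mpr (hgne w ω)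
    rw [add_sub_cancel_left, norm_smul, norm_smul, norm_inv, norm_norm, inv_mul_cancel₀ h0,
      Real.norm_of_nonneg hρ.le, mul_one]
  have hdi : Integrable (fun ω => g (w + ρ • ‖g w ω‖⁻¹ • g w ω) ω - g w ω) P :=
    Integrable.of_bound (hm1.sub hm0).aestronglyMeasurable (L * ρ) (Filter.Eventually.of_forall hd)
  have hi1 : Integrable (fun ω => g (w + ρ • ‖g w ω‖⁻¹ • g w ω) ω) P := by
    have h := hdi.add (hgint w)
    refine h.congr (Filter.Eventually.of_forall fun ω => ?_)
    simp
  rw [integral_inner hi1]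
  have e : ∫ ω, g (w + ρ • ‖g w ω‖⁻¹ • g w ω) ω ∂P
      = f' w + ∫ ω, (g (w + ρ • ‖g w ω‖⁻¹ • g w ω) ω - g w ω) ∂P := by
    rw [integral_sub hi1 (hgint w), hunbiased]; abel
  have hn : ‖∫ ω, (g (w + ρ • ‖g w ω‖⁻¹ • g w ω) ω - g w ω) ∂P‖ ≤ L * ρ := by
    have h := norm_integral_le_of_norm_le_const (μ := P) (Filter.Eventually.of_forall hd)
    simpa using h
  rw [e, inner_add_right, real_inner_self_eq_norm_sq]
  have h1 := (abs_le.mp (abs_real_inner_le_norm (f' w)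
    (∫ ω, (g (w + ρ • ‖g w ω‖⁻¹ • g w ω) ω - g w ω) ∂P))).1
  have h2 := mul_le_mul (hbound w) hn (norm_nonneg _) hG
  have h3 : 0 ≤ L ^ 2 * ρ ^ 2 := by positivity
  nlinarith [sq_nonneg ‖f' w‖]
end

section
/- Let k be a positive integer, ρ > 0, and w ∈ ℝ^k. Suppose σ_P² ∈ ℝ satisfies ρ² + ‖w‖₂²/k ≤ σ_P² ≤ exp(1/k)·(ρ² + ‖w‖₂²/k). Then (1/2)·[ (k·ρ² + ‖w‖₂²)/σ_P² − k + k·ln(σ_P²/ρ²) ] ≤ (1/2)·[ 1 + k·ln(1 + ‖w‖₂²/(k·ρ²)) ]. (The KL-divergence bound established inside the proof of Theorem 3 of the paper; the left-hand side equals the KL divergence KL(N(w, ρ²I_k) ‖ N(0, σ_P²I_k)) between isotropic Gaussians.) -/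
/-- The KL-divergence bound inside the proof of **Theorem 3**: if
`ρ² + ‖w‖²/k ≤ σ_P² ≤ exp(1/k)·(ρ² + ‖w‖²/k)`, then
`½[(kρ² + ‖w‖²)/σ_P² − k + k·ln(σ_P²/ρ²)] ≤ ½[1 + k·ln(1 + ‖w‖²/(kρ²))]`.
The left-hand side is `KL(N(w, ρ²I_k) ‖ N(0, σ_P²I_k))`. -/
theorem theorem3_kl_bound {k : ℕ} (hk : 0 < k) (ρ : ℝ) (hρ : 0 < ρ)
    (w : EuclideanSpace ℝ (Fin k)) (σP2 : ℝ)
    (h1 : ρ ^ 2 + ‖w‖ ^ 2 / k ≤ σP2)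
    (h2 : σP2 ≤ Real.exp (1 / k) * (ρ ^ 2 + ‖w‖ ^ 2 / k)) :
    (1 / 2) * ((k * ρ ^ 2 + ‖w‖ ^ 2) / σP2 - k + k * Real.log (σP2 / ρ ^ 2))
      ≤ (1 / 2) * (1 + k * Real.log (1 + ‖w‖ ^ 2 / (k * ρ ^ 2))) := by
  have hk' : (0 : ℝ) < k := by exact_mod_cast hk
  have hn : 0 ≤ ‖w‖ ^ 2 := by positivity
  generalize ‖w‖ ^ 2 = N at *
  have hA : 0 < ρ ^ 2 + N / k := by positivity
  have hs : 0 < σP2 := lt_of_lt_of_le hA h1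
  have e1 : (k * ρ ^ 2 + N) / σP2 ≤ k := by
    rw [div_le_iff₀ hs]
    have h := mul_le_mul_of_nonneg_left h1 hk'.le
    have h' : (k : ℝ) * (ρ ^ 2 + N / k) = k * ρ ^ 2 + N := by field_simp
    linarith
  have e2 : σP2 / ρ ^ 2 ≤ Real.exp (1 / k) * (1 + N / (k * ρ ^ 2)) := by
    rw [div_le_iff₀ (by positivity)]
    have h' : Real.exp (1 / k) * (1 + N / (k * ρ ^ 2)) * ρ ^ 2
        = Real.exp (1 / k) * (ρ ^ 2 + N / k) := by field_simp
    linarith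
  have e3 := Real.log_le_log (by positivity) e2
  have hB : (0 : ℝ) < 1 + N / (k * ρ ^ 2) := by positivity
  rw [Real.log_mul (Real.exp_pos _).ne' hB.ne', Real.log_exp] at e3
  have e4 := mul_le_mul_of_nonneg_left e3 hk'.le
  rw [mul_add, mul_one_div_cancel hk'.ne'] at e4
  linarith
end
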